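/- Let N ≥ 1, p ≥ 2 an integer, n_1, ..., n_N positive integers, and t_1, ..., t_N rational numbers satisfying p^{n_i} t_i ≥ t_{i+1} for all i (indices mod N, so p^{n_N} t_N ≥ t_1), with at least one inequality holding. If λ_1, ..., λ_N are the unique rationals with p^{n_{i-1}} λ_{i-1} - λ_i = t_i for all i (indices mod N), then λ_i ≥ 0 for all i. -/

import Mathlib

/-- A function on a finite type which, along some self-map `σ`, is bounded above by a multiple
`a i > 1` of its previous value is nonnegative: its minimum cannot be negative. -/
theorem nonneg_of_apply_le_mul {ι R : Type*} [Finite ι] [Ring R] [LinearOrder R]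
    [IsStrictOrderedRing R] (σ : ι → ι) {a x : ι → R} (ha : ∀ i, 1 < a i)
    (hx : ∀ i, x (σ i) ≤ a i * x i) (i : ι) : 0 ≤ x i := by
  have : Nonempty ι := ⟨i⟩
  obtain ⟨m, hm⟩ := Finite.exists_min x
  refine le_trans ?_ (hm i)
  by_contra! hneg
  have hlt : a m * x m < x m := by
    simpa using mul_lt_mul_of_neg_right (ha m) hneg
  exact (((hm (σ m)).trans (hx m)).trans_lt hlt).false

/-- If `p^{n_i} t_i ≥ t_{i+1}` for all `i` (indices mod `N`), with at least one strict
inequality, and `λ` is the solution of the cyclic system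
`p^{n_{i-1}} λ_{i-1} - λ_i = t_i`, then all `λ_i ≥ 0`. -/
theorem lambda_nonneg (N : ℕ) [NeZero N] (hN : 1 ≤ N)
    (p : ℕ) (hp : 2 ≤ p) (n : Fin N → ℕ) (hn : ∀ i, 0 < n i)
    (t lam : Fin N → ℚ)
    (ht : ∀ i, t (i + 1) ≤ (p : ℚ) ^ n i * t i)
    (htstrict : ∃ i, t (i + 1) < (p : ℚ) ^ n i * t i)
    (hlam : ∀ i, (p : ℚ) ^ n (i - 1) * lam (i - 1) - lam i = t i) :
    ∀ i, 0 ≤ lam i := by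
  have ha : ∀ i, (1 : ℚ) < (p : ℚ) ^ n i := fun i =>
    one_lt_pow₀ (by exact_mod_cast hp) (hn i).ne'
  have ht_nonneg : ∀ i, 0 ≤ t i := nonneg_of_apply_le_mul (· + 1) ha ht
  refine nonneg_of_apply_le_mul (· + 1) ha fun i => ?_
  have h := hlam (i + 1)
  rw [add_sub_cancel_right] at h
  linarith [ht_nonneg (i + 1)]
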